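/- (Lemma 1, trace and divergence parts.) Let Φ : U → ℝ be smooth with □Φ + 3Φ = 0 on U. Then the symmetric tensor T_{ab} = D_aD_bΦ + h⁰_{ab}Φ is traceless, Σ_{a,b} h⁰^{ab} T_{ab} = 0, and divergence-free, D^bT_{ab} = Σ_{b,c} h⁰^{bc} D_cT_{ab} = 0, at every point of U. -/

import Mathlib

noncomputable section

/-- Points of the chart `U = ℝ × (0,π) × ℝ` with coordinates `(τ, θ, φ)`. -/
abbrev Pt : Type := Fin 3 → ℝ

/-- The coordinate domain `U = ℝ × (0,π) × ℝ`. -/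
def U : Set Pt := {x | 0 < x 1 ∧ x 1 < Real.pi}

/-- Partial derivative `∂_i f` at `x`. -/
noncomputable def pd (i : Fin 3) (f : Pt → ℝ) (x : Pt) : ℝ :=
  deriv (fun t => f (Function.update x i t)) (x i)

/-- The unit-hyperboloid (dS₃) metric `h⁰_{ab}`. -/
noncomputable def h0 (x : Pt) : Fin 3 → Fin 3 → ℝ :=
  ![![-1, 0, 0],
    ![0, Real.cosh (x 0) ^ 2, 0],
    ![0, 0, Real.cosh (x 0) ^ 2 * Real.sin (x 1) ^ 2]]

/-- The inverse metric `h⁰^{ab}`. -/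
noncomputable def h0inv (x : Pt) : Fin 3 → Fin 3 → ℝ :=
  ![![-1, 0, 0],
    ![0, 1 / Real.cosh (x 0) ^ 2, 0],
    ![0, 0, 1 / (Real.cosh (x 0) ^ 2 * Real.sin (x 1) ^ 2)]]

/-- Christoffel symbols `Γ^c_{ab}` of `h⁰`; first index is the upper index. -/
noncomputable def Chr (x : Pt) : Fin 3 → Fin 3 → Fin 3 → ℝ :=
  ![![![0, 0, 0],
      ![0, Real.sinh (x 0) * Real.cosh (x 0), 0],
      ![0, 0, Real.sinh (x 0) * Real.cosh (x 0) * Real.sin (x 1) ^ 2]],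
    ![![0, Real.tanh (x 0), 0],
      ![Real.tanh (x 0), 0, 0],
      ![0, 0, -(Real.sin (x 1) * Real.cos (x 1))]],
    ![![0, 0, Real.tanh (x 0)],
      ![0, 0, Real.cos (x 1) / Real.sin (x 1)],
      ![Real.tanh (x 0), Real.cos (x 1) / Real.sin (x 1), 0]]]

/-- Covariant Hessian `D_a D_b f = ∂_a ∂_b f - Σ_c Γ^c_{ab} ∂_c f`. -/
noncomputable def hess (f : Pt → ℝ) (x : Pt) (a b : Fin 3) : ℝ :=
  pd a (pd b f) x - ∑ c, Chr x c a b * pd c f x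

/-- Covariant derivative `D_c T_{ab}` of a 2-tensor. -/
noncomputable def covD (T : Pt → Fin 3 → Fin 3 → ℝ) (x : Pt) (c a b : Fin 3) : ℝ :=
  pd c (fun y => T y a b) x - (∑ d, Chr x d c a * T x d b) - (∑ d, Chr x d c b * T x a d)

/-- Second covariant derivative `D_d D_c T_{ab}`, treating `D_c T_{ab}` as a 3-tensor. -/
noncomputable def covD2 (T : Pt → Fin 3 → Fin 3 → ℝ) (x : Pt) (d c a b : Fin 3) : ℝ :=
  pd d (fun y => covD T y c a b) x
    - (∑ e, Chr x e d c * covD T x e a b)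
    - (∑ e, Chr x e d a * covD T x c e b)
    - (∑ e, Chr x e d b * covD T x c a e)

/-- Tensor Laplacian `□T_{ab} = Σ_{c,d} h⁰^{cd} D_d D_c T_{ab}`. -/
noncomputable def boxT (T : Pt → Fin 3 → Fin 3 → ℝ) (x : Pt) (a b : Fin 3) : ℝ :=
  ∑ c, ∑ d, h0inv x c d * covD2 T x d c a b

/-- Totally antisymmetric Levi-Civita symbol with `levi 0 1 2 = 1`. -/
def levi : Fin 3 → Fin 3 → Fin 3 → ℝ :=
  ![![![0, 0, 0], ![0, 0, 1], ![0, -1, 0]],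
    ![![0, 0, -1], ![0, 0, 0], ![1, 0, 0]],
    ![![0, 1, 0], ![-1, 0, 0], ![0, 0, 0]]]

/-- Volume tensor `ε_{abc}` with `ε_{τθφ} = cosh²τ sinθ`. -/
noncomputable def epsLow (x : Pt) (a b c : Fin 3) : ℝ :=
  levi a b c * (Real.cosh (x 0) ^ 2 * Real.sin (x 1))

/-- `ε_a{}^{cd} = Σ_{e,f} ε_{aef} h⁰^{ec} h⁰^{fd}`. -/
noncomputable def epsMixed (x : Pt) (a c d : Fin 3) : ℝ :=
  ∑ e, ∑ f, epsLow x a e f * h0inv x e c * h0inv x f d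

/-- Curl of a 2-tensor: `(curl T)_{ab} = Σ_{c,d} ε_a{}^{cd} D_c T_{db}`. -/
noncomputable def curlT (T : Pt → Fin 3 → Fin 3 → ℝ) (x : Pt) (a b : Fin 3) : ℝ :=
  ∑ c, ∑ d, epsMixed x a c d * covD T x c d b

/-- Scalar Laplacian `□Φ = Σ_{a,b} h⁰^{ab} D_a D_b Φ`. -/
noncomputable def boxScalar (f : Pt → ℝ) (x : Pt) : ℝ :=
  ∑ a, ∑ b, h0inv x a b * hess f x a b

/-- `f` has partial derivative `f'` in the `i`-th coordinate direction at `x`. -/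
def HasPd (i : Fin 3) (f : Pt → ℝ) (f' : ℝ) (x : Pt) : Prop :=
  HasDerivAt (fun t => f (Function.update x i t)) f' (x i)

lemma HasPd.pd {i : Fin 3} {f : Pt → ℝ} {f' : ℝ} {x : Pt} (h : HasPd i f f' x) :
    pd i f x = f' := HasDerivAt.deriv h

lemma HasPd.add {i : Fin 3} {f g : Pt → ℝ} {f' g' : ℝ} {x : Pt}
    (hf : HasPd i f f' x) (hg : HasPd i g g' x) :
    HasPd i (fun y => f y + g y) (f' + g') x := HasDerivAt.add hf hg

lemma HasPd.sub {i : Fin 3} {f g : Pt → ℝ} {f' g' : ℝ} {x : Pt}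
    (hf : HasPd i f f' x) (hg : HasPd i g g' x) :
    HasPd i (fun y => f y - g y) (f' - g') x := HasDerivAt.sub hf hg

lemma HasPd.mul {i : Fin 3} {f g : Pt → ℝ} {f' g' : ℝ} {x : Pt}
    (hf : HasPd i f f' x) (hg : HasPd i g g' x) :
    HasPd i (fun y => f y * g y) (f' * g x + f x * g') x := by
  simpa [HasPd] using HasDerivAt.fun_mul hf hg

lemma HasPd.sum {i : Fin 3} {f : Fin 3 → Pt → ℝ} {f' : Fin 3 → ℝ} {x : Pt}
    (hf : ∀ d, HasPd i (f d) (f' d) x) :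
    HasPd i (fun y => ∑ d, f d y) (∑ d, f' d) x :=
  HasDerivAt.fun_sum fun d _ => hf d

lemma isOpen_U : IsOpen U :=
  (isOpen_lt continuous_const (continuous_apply 1)).inter
    (isOpen_lt (continuous_apply 1) continuous_const)

lemma hasPd_fderiv {f : Pt → ℝ} {x : Pt} (hf : DifferentiableAt ℝ f x) (i : Fin 3) :
    HasPd i f (fderiv ℝ f x (Pi.single i 1)) x := by
  have h : HasFDerivAt f (fderiv ℝ f x) (Function.update x i (x i)) := by
    simpa using hf.hasFDerivAt
  exact h.comp_hasDerivAt (x i) (hasDerivAt_update x i (x i))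

lemma differentiableAt_of_mem_U {f : Pt → ℝ} (hf : ContDiffOn ℝ (⊤ : ℕ∞) f U)
    {x : Pt} (hx : x ∈ U) : DifferentiableAt ℝ f x :=
  (hf.contDiffAt (isOpen_U.mem_nhds hx)).differentiableAt (by simp)

lemma hasPd_pd {f : Pt → ℝ} (hf : ContDiffOn ℝ (⊤ : ℕ∞) f U)
    {x : Pt} (hx : x ∈ U) (i : Fin 3) : HasPd i f (pd i f x) x := by
  have h := hasPd_fderiv (differentiableAt_of_mem_U hf hx) i
  rwa [h.pd]

lemma pd_eq_fderiv {f : Pt → ℝ} (hf : ContDiffOn ℝ (⊤ : ℕ∞) f U)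
    {x : Pt} (hx : x ∈ U) (i : Fin 3) :
    pd i f x = fderiv ℝ f x (Pi.single i 1) :=
  (hasPd_fderiv (differentiableAt_of_mem_U hf hx) i).pd

lemma contDiffOn_pd {f : Pt → ℝ} (hf : ContDiffOn ℝ (⊤ : ℕ∞) f U)
    (i : Fin 3) : ContDiffOn ℝ (⊤ : ℕ∞) (pd i f) U := by
  have h : ContDiffOn ℝ (⊤ : ℕ∞) (fderiv ℝ f) U := hf.fderiv_of_isOpen isOpen_U (by simp)
  exact (h.clm_apply contDiffOn_const).congr fun x hx => pd_eq_fderiv hf hx i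

lemma pd_pd_eq_fderiv {f : Pt → ℝ} (hf : ContDiffOn ℝ (⊤ : ℕ∞) f U)
    {x : Pt} (hx : x ∈ U) (i j : Fin 3) :
    pd i (pd j f) x = fderiv ℝ (fderiv ℝ f) x (Pi.single i 1) (Pi.single j 1) := by
  have h : ContDiffOn ℝ (⊤ : ℕ∞) (fderiv ℝ f) U := hf.fderiv_of_isOpen isOpen_U (by simp)
  have hd : DifferentiableAt ℝ (fderiv ℝ f) x :=
    (h.contDiffAt (isOpen_U.mem_nhds hx)).differentiableAt (by simp)
  have he : pd j f =ᶠ[nhds x] fun y => fderiv ℝ f y (Pi.single j 1) := by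
    filter_upwards [isOpen_U.mem_nhds hx] with y hy using pd_eq_fderiv hf hy j
  rw [pd_eq_fderiv (contDiffOn_pd hf j) hx, he.fderiv_eq,
    fderiv_clm_apply hd (differentiableAt_const _)]
  simp

lemma pd_comm {f : Pt → ℝ} (hf : ContDiffOn ℝ (⊤ : ℕ∞) f U)
    {x : Pt} (hx : x ∈ U) (i j : Fin 3) :
    pd i (pd j f) x = pd j (pd i f) x := by
  have h : IsSymmSndFDerivAt ℝ f x :=
    (hf.contDiffAt (isOpen_U.mem_nhds hx)).isSymmSndFDerivAt
      (by simpa using WithTop.coe_le_coe.2 (le_top : (2 : ℕ∞) ≤ ⊤))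
  rw [pd_pd_eq_fderiv hf hx, pd_pd_eq_fderiv hf hx, h.eq]

lemma hasPd_of_tau {g : ℝ → ℝ} {g' : ℝ} {x : Pt} (h : HasDerivAt g g' (x 0)) (i : Fin 3) :
    HasPd i (fun y => g (y 0)) (if i = 0 then g' else 0) x := by
  fin_cases i
  · simpa [HasPd] using h
  · simpa [HasPd] using hasDerivAt_const _ _
  · simpa [HasPd] using hasDerivAt_const _ _

lemma hasPd_of_theta {g : ℝ → ℝ} {g' : ℝ} {x : Pt} (h : HasDerivAt g g' (x 1)) (i : Fin 3) :
    HasPd i (fun y => g (y 1)) (if i = 1 then g' else 0) x := by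
  fin_cases i
  · simpa [HasPd] using hasDerivAt_const _ _
  · simpa [HasPd] using h
  · simpa [HasPd] using hasDerivAt_const _ _

lemma hasPd_const (i : Fin 3) (k : ℝ) (x : Pt) : HasPd i (fun _ => k) 0 x :=
  hasDerivAt_const _ _

lemma sin_ne_zero_of_mem_U {x : Pt} (hx : x ∈ U) : Real.sin (x 1) ≠ 0 :=
  (Real.sin_pos_of_pos_of_lt_pi hx.1 hx.2).ne'

/-- The partial derivative `∂_i h⁰_{ab}`. -/
def dh0 (x : Pt) (i : Fin 3) : Fin 3 → Fin 3 → ℝ :=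
  let P := if i = 0 then 2 * Real.cosh (x 0) * Real.sinh (x 0) else 0
  let Q := if i = 1 then 2 * Real.sin (x 1) * Real.cos (x 1) else 0
  ![![0, 0, 0],
    ![0, P, 0],
    ![0, 0, P * Real.sin (x 1) ^ 2 + Real.cosh (x 0) ^ 2 * Q]]

/-- The partial derivative `∂_i h⁰^{ab}`. -/
def dh0inv (x : Pt) (i : Fin 3) : Fin 3 → Fin 3 → ℝ :=
  let P := if i = 0 then -2 * Real.sinh (x 0) / Real.cosh (x 0) ^ 3 else 0
  let Q := if i = 1 then -2 * Real.cos (x 1) / Real.sin (x 1) ^ 3 else 0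
  ![![0, 0, 0],
    ![0, P, 0],
    ![0, 0, P * (1 / Real.sin (x 1) ^ 2) + 1 / Real.cosh (x 0) ^ 2 * Q]]

/-- The partial derivative `∂_i Γ^c_{ab}`. -/
def dChr (x : Pt) (i : Fin 3) : Fin 3 → Fin 3 → Fin 3 → ℝ :=
  let P := if i = 0 then Real.cosh (x 0) * Real.cosh (x 0) + Real.sinh (x 0) * Real.sinh (x 0)
    else 0
  let Q := if i = 1 then 2 * Real.sin (x 1) * Real.cos (x 1) else 0
  let R := if i = 0 then 1 / Real.cosh (x 0) ^ 2 else 0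
  let V := if i = 1 then Real.sin (x 1) * Real.sin (x 1) - Real.cos (x 1) * Real.cos (x 1) else 0
  let W := if i = 1 then -1 / Real.sin (x 1) ^ 2 else 0
  ![![![0, 0, 0],
      ![0, P, 0],
      ![0, 0, P * Real.sin (x 1) ^ 2 + Real.sinh (x 0) * Real.cosh (x 0) * Q]],
    ![![0, R, 0],
      ![R, 0, 0],
      ![0, 0, V]],
    ![![0, 0, R],
      ![0, 0, W],
      ![R, W, 0]]]

lemma hasDerivAt_cosh_sq (t : ℝ) :
    HasDerivAt (fun t => Real.cosh t ^ 2) (2 * Real.cosh t * Real.sinh t) t := by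
  simpa using (Real.hasDerivAt_cosh t).fun_pow 2

lemma hasDerivAt_sin_sq (t : ℝ) :
    HasDerivAt (fun t => Real.sin t ^ 2) (2 * Real.sin t * Real.cos t) t := by
  simpa using (Real.hasDerivAt_sin t).fun_pow 2

lemma hasDerivAt_tanh (t : ℝ) : HasDerivAt Real.tanh (1 / Real.cosh t ^ 2) t := by
  rw [funext Real.tanh_eq_sinh_div_cosh]
  refine ((Real.hasDerivAt_sinh t).fun_div (Real.hasDerivAt_cosh t)
    (Real.cosh_pos t).ne').congr_deriv ?_
  congr 1
  linear_combination Real.cosh_sq t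

lemma hasPd_h0 (x : Pt) (i a b : Fin 3) : HasPd i (fun y => h0 y a b) (dh0 x i a b) x := by
  have hP := hasPd_of_tau (hasDerivAt_cosh_sq (x 0)) i
  have hQ := hasPd_of_theta (hasDerivAt_sin_sq (x 1)) i
  have hPQ := hP.mul hQ
  have hc := hasPd_const i
  fin_cases a <;> fin_cases b <;> first | exact hc _ x | exact hP | exact hPQ

lemma hasPd_h0inv {x : Pt} (hx : x ∈ U) (i a b : Fin 3) :
    HasPd i (fun y => h0inv y a b) (dh0inv x i a b) x := by
  have hs := sin_ne_zero_of_mem_U hx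
  have hC := (Real.cosh_pos (x 0)).ne'
  have h1 : HasDerivAt (fun t => 1 / Real.cosh t ^ 2)
      (-2 * Real.sinh (x 0) / Real.cosh (x 0) ^ 3) (x 0) := by
    refine ((hasDerivAt_const (x 0) (1 : ℝ)).fun_div (hasDerivAt_cosh_sq (x 0))
      (pow_ne_zero 2 hC)).congr_deriv ?_
    field_simp
    ring
  have h2 : HasDerivAt (fun t => 1 / Real.sin t ^ 2)
      (-2 * Real.cos (x 1) / Real.sin (x 1) ^ 3) (x 1) := by
    refine ((hasDerivAt_const (x 1) (1 : ℝ)).fun_div (hasDerivAt_sin_sq (x 1))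
      (pow_ne_zero 2 hs)).congr_deriv ?_
    field_simp
    ring
  have hP := hasPd_of_tau h1 i
  have hPQ := hP.mul (hasPd_of_theta h2 i)
  simp only [one_div_mul_one_div] at hPQ
  have hc := hasPd_const i
  fin_cases a <;> fin_cases b <;> first | exact hc _ x | exact hP | exact hPQ

lemma hasPd_Chr {x : Pt} (hx : x ∈ U) (i c a b : Fin 3) :
    HasPd i (fun y => Chr y c a b) (dChr x i c a b) x := by
  have hs := sin_ne_zero_of_mem_U hx
  have hP := hasPd_of_tau ((Real.hasDerivAt_sinh (x 0)).fun_mul (Real.hasDerivAt_cosh (x 0))) i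
  have hPQ := hP.mul (hasPd_of_theta (hasDerivAt_sin_sq (x 1)) i)
  have hR := hasPd_of_tau (hasDerivAt_tanh (x 0)) i
  have h1 : HasDerivAt (fun t => -(Real.sin t * Real.cos t))
      (Real.sin (x 1) * Real.sin (x 1) - Real.cos (x 1) * Real.cos (x 1)) (x 1) := by
    refine ((Real.hasDerivAt_sin (x 1)).fun_mul (Real.hasDerivAt_cos (x 1))).fun_neg.congr_deriv ?_
    ring
  have h2 : HasDerivAt (fun t => Real.cos t / Real.sin t) (-1 / Real.sin (x 1) ^ 2) (x 1) := by
    refine ((Real.hasDerivAt_cos (x 1)).fun_div (Real.hasDerivAt_sin (x 1)) hs).congr_deriv ?_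
    congr 1
    linear_combination -Real.sin_sq_add_cos_sq (x 1)
  have hV := hasPd_of_theta h1 i
  have hW := hasPd_of_theta h2 i
  have hc := hasPd_const i
  fin_cases c <;> fin_cases a <;> fin_cases b <;>
    first | exact hc _ x | exact hP | exact hPQ | exact hR | exact hV | exact hW

lemma hasPd_hess {f : Pt → ℝ} (hf : ContDiffOn ℝ (⊤ : ℕ∞) f U)
    {x : Pt} (hx : x ∈ U) (i a b : Fin 3) :
    HasPd i (fun y => hess f y a b) (pd i (pd a (pd b f)) x -
      ∑ c, (dChr x i c a b * pd c f x + Chr x c a b * pd i (pd c f) x)) x :=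
  (hasPd_pd (contDiffOn_pd (contDiffOn_pd hf b) a) hx i).sub <| HasPd.sum fun c =>
    (hasPd_Chr hx i c a b).mul (hasPd_pd (contDiffOn_pd hf c) hx i)

lemma pd_hess_add_metric_mul {f : Pt → ℝ} (hf : ContDiffOn ℝ (⊤ : ℕ∞) f U)
    {x : Pt} (hx : x ∈ U) (i a b : Fin 3) :
    pd i (fun y => hess f y a b + h0 y a b * f y) x = (pd i (pd a (pd b f)) x -
      ∑ c, (dChr x i c a b * pd c f x + Chr x c a b * pd i (pd c f) x)) +
      (dh0 x i a b * f x + h0 x a b * pd i f x) :=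
  ((hasPd_hess hf hx i a b).add ((hasPd_h0 x i a b).mul (hasPd_pd hf hx i))).pd

lemma pd_boxScalar_add {f : Pt → ℝ} (hf : ContDiffOn ℝ (⊤ : ℕ∞) f U)
    {x : Pt} (hx : x ∈ U) (i : Fin 3) :
    pd i (fun y => boxScalar f y + 3 * f y) x =
      (∑ a, ∑ b, (dh0inv x i a b * hess f x a b + h0inv x a b * (pd i (pd a (pd b f)) x -
        ∑ c, (dChr x i c a b * pd c f x + Chr x c a b * pd i (pd c f) x)))) +
      (0 * f x + 3 * pd i f x) :=
  ((HasPd.sum fun a => HasPd.sum fun b =>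
    (hasPd_h0inv hx i a b).mul (hasPd_hess hf hx i a b)).add
      ((hasPd_const i 3 x).mul (hasPd_pd hf hx i))).pd

lemma pd_eq_zero_of_eqOn {f : Pt → ℝ} (h : ∀ x ∈ U, f x = 0) {x : Pt} (hx : x ∈ U)
    (i : Fin 3) : pd i f x = 0 := by
  have hc : ContDiffOn ℝ (⊤ : ℕ∞) f U := contDiffOn_const.congr h
  have he : f =ᶠ[nhds x] fun _ => (0 : ℝ) := by
    filter_upwards [isOpen_U.mem_nhds hx] with y hy using h y hy
  rw [pd_eq_fderiv hc hx, he.fderiv_eq]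
  simp

lemma sum_h0inv_mul_h0 {x : Pt} (hx : x ∈ U) : ∑ a, ∑ b, h0inv x a b * h0 x a b = 3 := by
  have hs := sin_ne_zero_of_mem_U hx
  have hC := (Real.cosh_pos (x 0)).ne'
  simp [Fin.sum_univ_three, h0inv, h0]
  field_simp
  norm_num

/-- Lemma 1 (trace and divergence parts): if `□Φ + 3Φ = 0` then
`T_{ab} = D_aD_bΦ + h⁰_{ab}Φ` is traceless and divergence-free on `U`. -/
theorem stmt5 (Φ : Pt → ℝ) (hΦ : ContDiffOn ℝ (⊤ : ℕ∞) Φ U)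
    (heq : ∀ x ∈ U, boxScalar Φ x + 3 * Φ x = 0) :
    ∀ x ∈ U,
      (∑ a, ∑ b, h0inv x a b * (hess Φ x a b + h0 x a b * Φ x)) = 0 ∧
      (∀ a : Fin 3,
        (∑ b, ∑ c, h0inv x b c *
          covD (fun y a' b' => hess Φ y a' b' + h0 y a' b' * Φ y) x c a b) = 0) := by
  intro x hx
  constructor
  · have h3 := sum_h0inv_mul_h0 hx
    have hb := heq x hx
    simp only [boxScalar, mul_add, ← mul_assoc, Finset.sum_add_distrib, ← Finset.sum_mul,
      h3] at hb ⊢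
    exact hb
  · intro a
    have hb := pd_eq_zero_of_eqOn heq hx a
    rw [pd_boxScalar_add hΦ hx] at hb
    have hs := sin_ne_zero_of_mem_U hx
    have hC := (Real.cosh_pos (x 0)).ne'
    have hcosh := Real.cosh_sq (x 0)
    have hsin := Real.sin_sq_add_cos_sq (x 1)
    have h10 := pd_comm hΦ hx 1 0
    have h20 := pd_comm hΦ hx 2 0
    have h21 := pd_comm hΦ hx 2 1
    have hthird0 := pd_comm (contDiffOn_pd hΦ 0) hx 0 a
    have hthird1 := pd_comm (contDiffOn_pd hΦ 1) hx 1 a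
    have hthird2 := pd_comm (contDiffOn_pd hΦ 2) hx 2 a
    simp only [covD, pd_hess_add_metric_mul hΦ hx]
    fin_cases a <;>
      simp only [Fin.zero_eta, Fin.mk_one, Fin.reduceFinMk] at hthird0 hthird1 hthird2 hb ⊢ <;>
      simp [Fin.sum_univ_three, hess, h0inv, h0, Chr, dChr, dh0, dh0inv,
        Real.tanh_eq_sinh_div_cosh, h10, h20, h21, hthird0, hthird1, hthird2] at hb ⊢ <;>
      clear hthird0 hthird1 hthird2 h10 h20 h21 heq hΦ <;>
      generalize Real.cosh (x 0) = C at * <;>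
      generalize Real.sinh (x 0) = S at * <;>
      generalize Real.sin (x 1) = s at * <;>
      generalize Real.cos (x 1) = c at *
    · refine Eq.trans ?_ hb
      field_simp
      ring
    · linear_combination (norm := (field_simp; ring)) hb - 2 / C ^ 2 * pd 1 Φ x * hcosh
    · linear_combination (norm := (field_simp; ring)) hb - 2 / C ^ 2 * pd 2 Φ x * hcosh -
        1 / (s ^ 2 * C ^ 2) * pd 2 Φ x * hsin
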